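/- arXiv:1803.10899 — 7 statements merged into one kernel-verified Lean document; each statement's English description precedes it below -/
import Mathlib

section
/- Let S_P ⊊ ℕ and S_Q ⊆ ℕ be numerical semigroups with gap sets G_P := ℕ ∖ S_P and G_Q := ℕ ∖ S_Q, and let γ := max G_P be the Frobenius number of S_P. Set A := {γ − g : g ∈ G_P} ∪ {γ + g : g ∈ G_Q} ⊆ ℕ. Then, as subsets of ℤ (with S_Q and G_Q regarded as subsets of ℤ via ℕ ⊆ ℤ): (⋃_{d ∈ A} {s − d : s ∈ S_Q}) ∖ S_Q = {−(γ + g) : g ∈ G_Q} ∪ {a ∈ ℤ : −γ < a < 0} ∪ G_Q. -/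
/-- Equation (22) of the paper: with `A = (γ − G_P) ∪ (γ + G_Q)` the exponent set of the
canonical model, the set `v_Q(W_Q) ∖ S_Q`, i.e. `(⋃_{d ∈ A} (S_Q − d)) ∖ S_Q ⊆ ℤ`, equals
`−(γ + G_Q) ∪ {a ∈ ℤ : −γ < a < 0} ∪ G_Q`. -/
theorem stmt_5 (SP SQ : Set ℕ)
    (hP0 : 0 ∈ SP) (hPadd : ∀ a ∈ SP, ∀ b ∈ SP, a + b ∈ SP) (hPfin : SPᶜ.Finite)
    (hPne : SP ≠ Set.univ)
    (hQ0 : 0 ∈ SQ) (hQadd : ∀ a ∈ SQ, ∀ b ∈ SQ, a + b ∈ SQ) (hQfin : SQᶜ.Finite)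
    (γ : ℕ) (hγ : γ ∉ SP) (hγmax : ∀ g : ℕ, g ∉ SP → g ≤ γ) :
    {x : ℤ | ∃ d ∈ ({n : ℕ | ∃ g : ℕ, g ∉ SP ∧ n = γ - g}
          ∪ {n : ℕ | ∃ g : ℕ, g ∉ SQ ∧ n = γ + g}),
        ∃ s ∈ SQ, x = (s : ℤ) - (d : ℤ)} \ {x : ℤ | ∃ s ∈ SQ, x = (s : ℤ)}
      = {x : ℤ | ∃ g : ℕ, g ∉ SQ ∧ x = -((γ : ℤ) + (g : ℤ))}
        ∪ {x : ℤ | -(γ : ℤ) < x ∧ x < 0}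
        ∪ {x : ℤ | ∃ g : ℕ, g ∉ SQ ∧ x = (g : ℤ)} := by
  have h1 : 1 ∉ SP := by
    intro h
    have hall : ∀ n : ℕ, n ∈ SP := by
      intro n
      induction n with
      | zero => exact hP0
      | succ k ih => exact hPadd k ih 1 h
    exact hγ (hall γ)
  have hγ1 : 1 ≤ γ := hγmax 1 h1
  -- everything above `-γ` lies in the union
  have key : ∀ x : ℤ, -(γ : ℤ) < x →
      ∃ d ∈ ({n : ℕ | ∃ g : ℕ, g ∉ SP ∧ n = γ - g} ∪ {n : ℕ | ∃ g : ℕ, g ∉ SQ ∧ n = γ + g}),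
        ∃ s ∈ SQ, x = (s : ℤ) - (d : ℤ) := by
    intro x hx
    by_cases hQ : (SQᶜ).Nonempty
    · obtain ⟨f, hf, hmax⟩ := Set.exists_max_image SQᶜ id hQfin hQ
      refine ⟨γ + f, Or.inr ⟨f, hf, rfl⟩, (x + γ + f).toNat, ?_, by omega⟩
      by_contra hs
      have := hmax _ hs
      simp only [id] at this
      omega
    · have hall : ∀ n : ℕ, n ∈ SQ := by
        intro n
        by_contra hn
        exact hQ ⟨n, hn⟩
      exact ⟨γ - 1, Or.inl ⟨1, h1, rfl⟩, (x + γ - 1).toNat, hall _, by omega⟩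
  ext x
  constructor
  · rintro ⟨⟨d, hd, s, hs, hx⟩, hxS⟩
    by_cases hx0 : 0 ≤ x
    · refine Or.inr ⟨x.toNat, fun h => hxS ⟨_, h, by omega⟩, by omega⟩
    · refine Or.inl ?_
      by_cases hxγ : -(γ : ℤ) < x
      · exact Or.inr ⟨hxγ, by omega⟩
      · refine Or.inl ?_
        rcases hd with ⟨g, hg, hdg⟩ | ⟨g, hg, hdg⟩
        · exfalso
          have hg0 : g ≠ 0 := fun h => hg (h ▸ hP0)
          omega
        · refine ⟨g - s, fun h => hg ?_, by omega⟩
          have h2 := hQadd s hs _ h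
          have h3 : s + (g - s) = g := by omega
          rwa [h3] at h2
  · rintro ((⟨g, hg, hx⟩ | ⟨hx1, hx2⟩) | ⟨g, hg, hx⟩)
    · refine ⟨⟨γ + g, Or.inr ⟨g, hg, rfl⟩, 0, hQ0, by push_cast; omega⟩, ?_⟩
      rintro ⟨s, hs, h⟩
      omega
    · refine ⟨key x hx1, ?_⟩
      rintro ⟨s, hs, h⟩
      omega
    · refine ⟨key x (by omega), ?_⟩
      rintro ⟨s, hs, h⟩
      have : s = g := by omega
      exact hg (this ▸ hs)
end

section
/- Let S_P ⊊ ℕ and S_Q ⊆ ℕ be numerical semigroups with gap sets G_P := ℕ ∖ S_P and G_Q := ℕ ∖ S_Q, let γ := max G_P be the Frobenius number of S_P, and let δ_Q := #G_Q. Set A := {γ − g : g ∈ G_P} ∪ {γ + g : g ∈ G_Q} ⊆ ℕ. Then the finite set (⋃_{d ∈ A} {s − d : s ∈ S_Q}) ∖ S_Q ⊆ ℤ has exactly 2δ_Q + γ − 1 elements. -/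
/-- Equation (23) of the paper: with `A = (γ − G_P) ∪ (γ + G_Q)` the exponent set of the
canonical model, the finite set `(⋃_{d ∈ A} (S_Q − d)) ∖ S_Q ⊆ ℤ` has exactly
`2δ_Q + γ − 1` elements (i.e. `dim(W_Q/O_Q) = 2δ_Q + β_P − 2` with `β_P = γ + 1`). -/
theorem stmt_6 (SP SQ : Set ℕ)
    (hP0 : 0 ∈ SP) (hPadd : ∀ a ∈ SP, ∀ b ∈ SP, a + b ∈ SP) (hPfin : SPᶜ.Finite)
    (hPne : SP ≠ Set.univ)
    (hQ0 : 0 ∈ SQ) (hQadd : ∀ a ∈ SQ, ∀ b ∈ SQ, a + b ∈ SQ) (hQfin : SQᶜ.Finite)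
    (γ : ℕ) (hγ : γ ∉ SP) (hγmax : ∀ g : ℕ, g ∉ SP → g ≤ γ) :
    (({x : ℤ | ∃ d ∈ ({n : ℕ | ∃ g : ℕ, g ∉ SP ∧ n = γ - g}
          ∪ {n : ℕ | ∃ g : ℕ, g ∉ SQ ∧ n = γ + g}),
        ∃ s ∈ SQ, x = (s : ℤ) - (d : ℤ)} \ {x : ℤ | ∃ s ∈ SQ, x = (s : ℤ)}).ncard : ℤ)
      = 2 * ({g : ℕ | g ∉ SQ}.ncard : ℤ) + (γ : ℤ) - 1 := by
  classical
  have hγ0 : 0 < γ := by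
    rcases Nat.eq_zero_or_pos γ with h | h
    · subst h; exact absurd hP0 hγ
    · exact h
  have h1 : 1 ∉ SP := by
    intro h1
    apply hPne
    ext n
    simp only [Set.mem_univ, iff_true]
    induction n with
    | zero => exact hP0
    | succ k ih => exact hPadd k ih 1 h1
  have hGfin : {g : ℕ | g ∉ SQ}.Finite := hQfin
  -- for every positive integer y and nonempty gap set, y is an element minus a gap
  have hpos : (∃ g, g ∉ SQ) → ∃ f, f ∉ SQ ∧ ∀ g, g ∉ SQ → g ≤ f := by
    rintro ⟨g, hg⟩
    obtain ⟨f, hf, hm⟩ := Set.exists_max_image {g : ℕ | g ∉ SQ} id hGfin ⟨g, hg⟩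
    exact ⟨f, hf, fun g hg => hm g hg⟩
  have key : ({x : ℤ | ∃ d ∈ ({n : ℕ | ∃ g : ℕ, g ∉ SP ∧ n = γ - g}
          ∪ {n : ℕ | ∃ g : ℕ, g ∉ SQ ∧ n = γ + g}),
        ∃ s ∈ SQ, x = (s : ℤ) - (d : ℤ)} \ {x : ℤ | ∃ s ∈ SQ, x = (s : ℤ)})
      = (Set.Ioo (-(γ : ℤ)) 0 ∪ (fun g : ℕ => (g : ℤ)) '' {g : ℕ | g ∉ SQ})
        ∪ (fun g : ℕ => -(γ : ℤ) - (g : ℤ)) '' {g : ℕ | g ∉ SQ} := by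
    ext x
    simp only [Set.mem_sdiff, Set.mem_setOf_eq, Set.mem_union, Set.mem_Ioo, Set.mem_image]
    constructor
    · rintro ⟨⟨d, hd, s, hs, hx⟩, hn⟩
      have hbig : -(γ : ℤ) < x → (-(γ : ℤ) < x ∧ x < 0) ∨ ∃ g, g ∉ SQ ∧ (g : ℤ) = x := by
        intro h
        rcases lt_or_ge x 0 with h0 | h0
        · exact Or.inl ⟨h, h0⟩
        · right
          lift x to ℕ using h0
          exact ⟨x, fun hxs => hn ⟨x, hxs, rfl⟩, rfl⟩
      rcases hd with ⟨g, hg, rfl⟩ | ⟨g, hg, rfl⟩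
      · left
        apply hbig
        have : g ≠ 0 := fun h => hg (h ▸ hP0)
        omega
      · rcases lt_trichotomy s g with h | h | h
        · right
          refine ⟨g - s, fun hgs => hg ?_, by omega⟩
          have := hQadd _ hgs _ hs
          rwa [Nat.sub_add_cancel h.le] at this
        · exact absurd (h ▸ hs) hg
        · left
          apply hbig
          omega
    · have hbig : -(γ : ℤ) < x → ∃ d, ((∃ g, g ∉ SP ∧ d = γ - g) ∨ ∃ g, g ∉ SQ ∧ d = γ + g) ∧
          ∃ s ∈ SQ, x = (s : ℤ) - (d : ℤ) := by
        intro h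
        by_cases hne : ∃ g, g ∉ SQ
        · obtain ⟨f, hf, hm⟩ := hpos hne
          refine ⟨γ + f, Or.inr ⟨f, hf, rfl⟩, (x + γ + f).toNat, ?_, by omega⟩
          by_contra hc
          have := hm _ hc
          omega
        · push Not at hne
          exact ⟨γ - 1, Or.inl ⟨1, h1, rfl⟩, (x + γ - 1).toNat, hne _, by omega⟩
      rintro ((⟨ha, hb⟩ | ⟨g, hg, rfl⟩) | ⟨g, hg, rfl⟩)
      · refine ⟨hbig ha, ?_⟩
        rintro ⟨s, _, hs⟩
        omega
      · refine ⟨hbig (by omega), ?_⟩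
        rintro ⟨s, hs, he⟩
        have : g = s := by exact_mod_cast he
        exact hg (this ▸ hs)
      · refine ⟨⟨γ + g, Or.inr ⟨g, hg, rfl⟩, 0, hQ0, by push_cast; ring⟩, ?_⟩
        rintro ⟨s, _, hs⟩
        omega
  rw [key, Set.ncard_union_eq _ ((Set.finite_Ioo _ _).union (hGfin.image _)) (hGfin.image _),
    Set.ncard_union_eq _ (Set.finite_Ioo _ _) (hGfin.image _),
    Set.ncard_image_of_injective, Set.ncard_image_of_injective]
  · have : (Set.Ioo (-(γ : ℤ)) 0).ncard = γ - 1 := by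
      rw [← Finset.coe_Ioo, Set.ncard_coe_finset, Int.card_Ioo]
      omega
    rw [this]
    omega
  · intro a b h
    simpa using h
  · intro a b h
    simpa using h
  · rw [Set.disjoint_left]
    rintro x ⟨_, hx⟩ ⟨g, _, rfl⟩
    simp only at hx
    omega
  · rw [Set.disjoint_left]
    rintro x (⟨hx, _⟩ | ⟨g', _, rfl⟩) ⟨g, _, hg⟩
    · simp only at hg
      omega
    · simp only at hg
      omega
end

section
/- Let S_P ⊊ ℕ and S_Q ⊆ ℕ be numerical semigroups with gap sets G_P := ℕ ∖ S_P and G_Q := ℕ ∖ S_Q, genera δ_P := #G_P and δ_Q := #G_Q, and let γ := max G_P be the Frobenius number of S_P. Set A := {γ − g : g ∈ G_P} ∪ {γ + g : g ∈ G_Q} ⊆ ℕ. Then #{a ∈ ℕ : a ∉ S_P and γ − a ∉ S_P} + #((⋃_{d ∈ A} {s − d : s ∈ S_Q}) ∖ S_Q) = 2(δ_P + δ_Q) − 2, where γ − a is computed in ℤ. -/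
/-- The computation `deg(W) = 2g − 2` for the sheaf `W` generated by the monomials
`t^a, a ∈ A = (γ − G_P) ∪ (γ + G_Q)`, on a rational monomial curve of genus
`g = δ_P + δ_Q`: the number of `a ∈ ℕ` with `a ∉ S_P` and `γ − a ∉ S_P` (computed in `ℤ`)
plus the cardinality of `(⋃_{d ∈ A} (S_Q − d)) ∖ S_Q` equals `2(δ_P + δ_Q) − 2`. -/
theorem stmt_7 (SP SQ : Set ℕ)
    (hP0 : 0 ∈ SP) (hPadd : ∀ a ∈ SP, ∀ b ∈ SP, a + b ∈ SP) (hPfin : SPᶜ.Finite)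
    (hPne : SP ≠ Set.univ)
    (hQ0 : 0 ∈ SQ) (hQadd : ∀ a ∈ SQ, ∀ b ∈ SQ, a + b ∈ SQ) (hQfin : SQᶜ.Finite)
    (γ : ℕ) (hγ : γ ∉ SP) (hγmax : ∀ g : ℕ, g ∉ SP → g ≤ γ) :
    (({a : ℕ | a ∉ SP ∧ ∀ s ∈ SP, (s : ℤ) ≠ (γ : ℤ) - (a : ℤ)}.ncard : ℤ)
      + (({x : ℤ | ∃ d ∈ ({n : ℕ | ∃ g : ℕ, g ∉ SP ∧ n = γ - g}
            ∪ {n : ℕ | ∃ g : ℕ, g ∉ SQ ∧ n = γ + g}),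
          ∃ s ∈ SQ, x = (s : ℤ) - (d : ℤ)} \ {x : ℤ | ∃ s ∈ SQ, x = (s : ℤ)}).ncard : ℤ))
      = 2 * (({g : ℕ | g ∉ SP}.ncard : ℤ) + ({g : ℕ | g ∉ SQ}.ncard : ℤ)) - 2 := by
  classical
  have hGP : {g : ℕ | g ∉ SP}.Finite := hPfin
  have hGQ : {g : ℕ | g ∉ SQ}.Finite := hQfin
  have h1P : 1 ∉ SP := by
    intro h1
    have : ∀ n : ℕ, n ∈ SP := by
      intro n
      induction n with
      | zero => exact hP0
      | succ k ih => exact hPadd k ih 1 h1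
    exact hγ (this γ)
  have hγ1 : 1 ≤ γ := hγmax 1 h1P
  -- first count
  have hTfin : {s : ℕ | s ∈ SP ∧ s ≤ γ}.Finite := (Set.finite_Iic γ).subset (fun s hs => hs.2)
  have e1 : {g : ℕ | g ∉ SP}.ncard + {s : ℕ | s ∈ SP ∧ s ≤ γ}.ncard = γ + 1 := by
    rw [← Set.ncard_union_eq _ hGP hTfin]
    · have : {g : ℕ | g ∉ SP} ∪ {s : ℕ | s ∈ SP ∧ s ≤ γ} = ((Finset.range (γ + 1) : Finset ℕ) : Set ℕ) := by
        ext x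
        have := hγmax x
        simp only [Set.mem_union, Set.mem_setOf_eq, Finset.coe_range, Set.mem_Iio]
        by_cases hx : x ∈ SP
        · simp [hx]
          try omega
        · have := this hx
          simp [hx]
          try omega
      rw [this, Set.ncard_coe_finset, Finset.card_range]
    · rw [Set.disjoint_left]
      rintro x hx ⟨hx', _⟩
      exact hx hx'
  have e2 : {a : ℕ | a ∉ SP ∧ ∀ s ∈ SP, (s : ℤ) ≠ (γ : ℤ) - (a : ℤ)}.ncard
      + {s : ℕ | s ∈ SP ∧ s ≤ γ}.ncard = {g : ℕ | g ∉ SP}.ncard := by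
    have hinj : Set.InjOn (fun s : ℕ => γ - s) {s : ℕ | s ∈ SP ∧ s ≤ γ} := by
      rintro a ⟨_, ha⟩ b ⟨_, hb⟩ hab
      simp only at hab
      omega
    rw [← Set.ncard_image_of_injOn hinj, ← Set.ncard_union_eq _ (hGP.subset fun a ha => ha.1) (hTfin.image _)]
    · congr 1
      ext x
      simp only [Set.mem_union, Set.mem_setOf_eq, Set.mem_image]
      constructor
      · rintro (h | ⟨s, ⟨hs, hsγ⟩, rfl⟩)
        · exact h.1
        · intro h
          apply hγ
          have := hPadd _ h _ hs
          rwa [Nat.sub_add_cancel hsγ] at this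
      · intro hx
        have hxγ := hγmax x hx
        by_cases h : γ - x ∈ SP
        · right
          exact ⟨γ - x, ⟨h, by omega⟩, by omega⟩
        · left
          refine ⟨hx, fun s hs hsx => h ?_⟩
          have : γ - x = s := by omega
          rwa [this]
    · rw [Set.disjoint_left]
      rintro x ⟨_, hx⟩ ⟨s, ⟨hs, hsγ⟩, hsx⟩
      simp only at hsx
      exact hx s hs (by omega)
  -- second count
  have key : ({x : ℤ | ∃ d ∈ ({n : ℕ | ∃ g : ℕ, g ∉ SP ∧ n = γ - g}
            ∪ {n : ℕ | ∃ g : ℕ, g ∉ SQ ∧ n = γ + g}),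
          ∃ s ∈ SQ, x = (s : ℤ) - (d : ℤ)} \ {x : ℤ | ∃ s ∈ SQ, x = (s : ℤ)})
      = ((fun y : ℕ => -(γ : ℤ) - y) '' {g : ℕ | g ∉ SQ} ∪ ((Finset.Ioo (-(γ : ℤ)) 0 : Finset ℤ) : Set ℤ))
        ∪ (fun y : ℕ => (y : ℤ)) '' {g : ℕ | g ∉ SQ} := by
    ext x
    simp only [Set.mem_union, Set.mem_setOf_eq, Set.mem_image, Set.mem_diff, Finset.coe_Ioo,
      Set.mem_Ioo]
    constructor
    · rintro ⟨⟨d, hd, s, hs, rfl⟩, hx⟩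
      by_cases h0 : (0 : ℤ) ≤ (s : ℤ) - d
      · right
        exact ⟨s - d, fun h => hx ⟨s - d, h, by omega⟩, by omega⟩
      · left
        by_cases h1 : -(γ : ℤ) < (s : ℤ) - d
        · right
          exact ⟨h1, by omega⟩
        · left
          rcases hd with ⟨g, hg, rfl⟩ | ⟨g, hg, rfl⟩
          · exfalso
            have : g ≠ 0 := fun h => hg (h ▸ hP0)
            omega
          · refine ⟨g - s, fun h => hg ?_, by omega⟩
            have := hQadd _ h _ hs
            rwa [Nat.sub_add_cancel (by omega)] at this
    · have big : ∀ x : ℤ, -(γ : ℤ) < x → ∃ d : ℕ, ((∃ g : ℕ, g ∉ SP ∧ d = γ - g)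
            ∨ (∃ g : ℕ, g ∉ SQ ∧ d = γ + g)) ∧ ∃ s ∈ SQ, x = (s : ℤ) - (d : ℤ) := by
        intro x hx
        by_cases hne : {g : ℕ | g ∉ SQ}.Nonempty
        · obtain ⟨F, hF, hmax⟩ := Set.exists_max_image _ (fun n : ℕ => n) hGQ hne
          refine ⟨γ + F, Or.inr ⟨F, hF, rfl⟩, (x + γ + F).toNat, ?_, by omega⟩
          by_contra h
          have := hmax _ h
          omega
        · refine ⟨γ - 1, Or.inl ⟨1, h1P, rfl⟩, (x + γ - 1).toNat, ?_, by omega⟩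
          by_contra h
          exact hne ⟨_, h⟩
      rintro ((⟨y, hy, rfl⟩ | ⟨h1, h2⟩) | ⟨y, hy, rfl⟩)
      · refine ⟨⟨γ + y, Or.inr ⟨y, hy, rfl⟩, 0, hQ0, by push_cast; ring⟩, ?_⟩
        rintro ⟨s, _, h⟩
        omega
      · refine ⟨big x h1, ?_⟩
        rintro ⟨s, _, h⟩
        omega
      · refine ⟨big _ (by omega), ?_⟩
        rintro ⟨s, hs, h⟩
        have : y = s := by omega
        exact hy (this ▸ hs)
  rw [key, Set.ncard_union_eq _ ((hGQ.image _).union (Finset.finite_toSet _)) (hGQ.image _),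
    Set.ncard_union_eq _ (hGQ.image _) (Finset.finite_toSet _), Set.ncard_image_of_injective,
    Set.ncard_image_of_injective, Set.ncard_coe_finset, Int.card_Ioo]
  · omega
  · intro a b h
    simp only at h
    omega
  · intro a b h
    simp only at h
    omega
  · rw [Set.disjoint_left]
    rintro x ⟨y, _, rfl⟩ h
    simp only [Finset.coe_Ioo, Set.mem_Ioo] at h
    omega
  · rw [Set.disjoint_left]
    rintro x (⟨y, _, rfl⟩ | h) ⟨z, _, hz⟩
    · simp only at hz
      omega
    · simp only [Finset.coe_Ioo, Set.mem_Ioo] at h hz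
      omega
end

section
/- Let S_P ⊊ ℕ and S_Q ⊆ ℕ be numerical semigroups with gap sets G_P := ℕ ∖ S_P and G_Q := ℕ ∖ S_Q, and let γ := max G_P be the Frobenius number of S_P. Set A := {γ − g : g ∈ G_P} ∪ {γ + g : g ∈ G_Q} ⊆ ℕ. Then for every integer r ≥ 1: #{s ∈ S_P : s + r ∉ S_P} + #{s ∈ S_Q : s − r ∉ S_Q} ≥ #{e ∈ A : e + r ∉ A} + 1, where s − r is computed in ℤ and negative integers are not elements of S_Q (all three sets are finite). -/
/-- In the proof of Theorem 4.3 of the paper: for `A = (γ − G_P) ∪ (γ + G_Q)`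
the exponent set of the canonical model and any integer `r ≥ 1`, the degree
`#{s ∈ S_P : s + r ∉ S_P} + #{s ∈ S_Q : s − r ∉ S_Q}` (with `s − r` computed in `ℤ`)
is at least the number of ending elements `e ∈ A` with `e + r ∉ A`, plus one. -/
theorem stmt_8 (SP SQ : Set ℕ)
    (hP0 : 0 ∈ SP) (hPadd : ∀ a ∈ SP, ∀ b ∈ SP, a + b ∈ SP) (hPfin : SPᶜ.Finite)
    (hPne : SP ≠ Set.univ)
    (hQ0 : 0 ∈ SQ) (hQadd : ∀ a ∈ SQ, ∀ b ∈ SQ, a + b ∈ SQ) (hQfin : SQᶜ.Finite)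
    (γ : ℕ) (hγ : γ ∉ SP) (hγmax : ∀ g : ℕ, g ∉ SP → g ≤ γ)
    (r : ℕ) (hr : 1 ≤ r) :
    {s : ℕ | s ∈ SP ∧ s + r ∉ SP}.ncard
      + {s : ℕ | s ∈ SQ ∧ ∀ u ∈ SQ, (u : ℤ) ≠ (s : ℤ) - (r : ℤ)}.ncard
      ≥ {e : ℕ | e ∈ ({n : ℕ | ∃ g : ℕ, g ∉ SP ∧ n = γ - g}
            ∪ {n : ℕ | ∃ g : ℕ, g ∉ SQ ∧ n = γ + g})
          ∧ e + r ∉ ({n : ℕ | ∃ g : ℕ, g ∉ SP ∧ n = γ - g}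
            ∪ {n : ℕ | ∃ g : ℕ, g ∉ SQ ∧ n = γ + g})}.ncard + 1 := by
  have hF1 : {s : ℕ | s ∈ SP ∧ s + r ∉ SP}.Finite := by
    apply (Set.finite_Iic γ).subset
    rintro s ⟨_, h⟩
    have := hγmax _ h
    simp only [Set.mem_Iic]
    omega
  have hF2 : {s : ℕ | s ∈ SQ ∧ ∀ u ∈ SQ, (u : ℤ) ≠ (s : ℤ) - (r : ℤ)}.Finite := by
    apply ((Set.finite_Iio r).union (hQfin.image (fun x => x + r))).subset
    rintro s ⟨_, h⟩
    by_cases hs : s < r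
    · exact Or.inl hs
    · refine Or.inr ⟨s - r, fun hm => h _ hm (by omega), by simp only; omega⟩
  have h0 : 0 ∈ {s : ℕ | s ∈ SQ ∧ ∀ u ∈ SQ, (u : ℤ) ≠ (s : ℤ) - (r : ℤ)} :=
    ⟨hQ0, fun u _ => by omega⟩
  rw [← Set.ncard_diff_singleton_add_one h0 hF2, ← add_assoc]
  apply Nat.add_le_add_right
  refine le_trans ?_ (Nat.add_le_add
    (Set.ncard_image_le (f := fun s => γ - r - s) hF1)
    (Set.ncard_image_le (f := fun s => γ + s - r) (hF2.diff (t := {0}))))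
  refine le_trans (Set.ncard_le_ncard ?_ ((hF1.image _).union ((hF2.diff).image _)))
    (Set.ncard_union_le _ _)
  rintro e ⟨he, hne⟩
  have hn1 : ∀ g : ℕ, e + r = γ - g → g ∈ SP := fun g hg => by
    by_contra hc
    exact hne (Or.inl ⟨g, hc, hg⟩)
  have hn2 : ∀ g : ℕ, e + r = γ + g → g ∈ SQ := fun g hg => by
    by_contra hc
    exact hne (Or.inr ⟨g, hc, hg⟩)
  by_cases hle : e + r ≤ γ
  · left
    refine ⟨γ - (e + r), ⟨hn1 _ (by omega), ?_⟩, by simp only; omega⟩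
    rcases he with ⟨g, hg, rfl⟩ | ⟨g, hg, rfl⟩
    · have := hγmax g hg
      have h : γ - (γ - g + r) + r = g := by omega
      rwa [h]
    · omega
  · right
    refine ⟨e + r - γ, ⟨⟨hn2 _ (by omega), ?_⟩, ?_⟩, by simp only; omega⟩
    · intro u hu hur
      rcases he with ⟨g, hg, rfl⟩ | ⟨g, hg, rfl⟩
      · have h1 := hγmax g hg
        have h2 : g ≠ 0 := fun h => hg (h ▸ hP0)
        omega
      · have h : u = g := by omega
        exact hg (h ▸ hu)
    · simp only [Set.mem_singleton_iff]
      omega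
end

section
/- Let S_P ⊊ ℕ and S_Q ⊆ ℕ be numerical semigroups with gap sets G_P := ℕ ∖ S_P and G_Q := ℕ ∖ S_Q, and let γ := max G_P be the Frobenius number of S_P. Set A := {γ − g : g ∈ G_P} ∪ {γ + g : g ∈ G_Q} ⊆ ℕ. Let r ≥ 1 be an integer and suppose that for every s ∈ S_Q with 0 < s < r one has r − s ∉ S_P. Then #{s ∈ S_P : s + r ∉ S_P} + #{s ∈ S_Q : s − r ∉ S_Q} = #{e ∈ A : e + r ∉ A} + 1, where s − r is computed in ℤ and negative integers are not elements of S_Q. -/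
/-- In the proof of Theorem 4.3 of the paper: for `A = (γ − G_P) ∪ (γ + G_Q)`
the exponent set of the canonical model and an integer `r ≥ 1` such that for every
`s ∈ S_Q` with `0 < s < r` one has `r − s ∉ S_P`, the degree
`#{s ∈ S_P : s + r ∉ S_P} + #{s ∈ S_Q : s − r ∉ S_Q}` (with `s − r` computed in `ℤ`)
equals the number of ending elements `e ∈ A` with `e + r ∉ A`, plus one. -/
theorem stmt_9 (SP SQ : Set ℕ)
    (hP0 : 0 ∈ SP) (hPadd : ∀ a ∈ SP, ∀ b ∈ SP, a + b ∈ SP) (hPfin : SPᶜ.Finite)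
    (hPne : SP ≠ Set.univ)
    (hQ0 : 0 ∈ SQ) (hQadd : ∀ a ∈ SQ, ∀ b ∈ SQ, a + b ∈ SQ) (hQfin : SQᶜ.Finite)
    (γ : ℕ) (hγ : γ ∉ SP) (hγmax : ∀ g : ℕ, g ∉ SP → g ≤ γ)
    (r : ℕ) (hr : 1 ≤ r)
    (hcond : ∀ s ∈ SQ, 0 < s → s < r → r - s ∉ SP) :
    {s : ℕ | s ∈ SP ∧ s + r ∉ SP}.ncard
      + {s : ℕ | s ∈ SQ ∧ ∀ u ∈ SQ, (u : ℤ) ≠ (s : ℤ) - (r : ℤ)}.ncard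
      = {e : ℕ | e ∈ ({n : ℕ | ∃ g : ℕ, g ∉ SP ∧ n = γ - g}
            ∪ {n : ℕ | ∃ g : ℕ, g ∉ SQ ∧ n = γ + g})
          ∧ e + r ∉ ({n : ℕ | ∃ g : ℕ, g ∉ SP ∧ n = γ - g}
            ∪ {n : ℕ | ∃ g : ℕ, g ∉ SQ ∧ n = γ + g})}.ncard + 1 := by
  have hA : ∀ n : ℕ, n ∈ ({n : ℕ | ∃ g : ℕ, g ∉ SP ∧ n = γ - g}
            ∪ {n : ℕ | ∃ g : ℕ, g ∉ SQ ∧ n = γ + g}) ↔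
      (n ≤ γ ∧ γ - n ∉ SP) ∨ (γ ≤ n ∧ n - γ ∉ SQ) := by
    intro n
    constructor
    · rintro (⟨g, hg, rfl⟩ | ⟨g, hg, rfl⟩)
      · left
        have := hγmax g hg
        refine ⟨by omega, ?_⟩
        rwa [show γ - (γ - g) = g by omega]
      · right
        refine ⟨by omega, ?_⟩
        rwa [show γ + g - γ = g by omega]
    · rintro (⟨h, hg⟩ | ⟨h, hg⟩)
      · exact Or.inl ⟨_, hg, by omega⟩
      · exact Or.inr ⟨_, hg, by omega⟩
  simp only [hA]
  set X1 := {s : ℕ | s ∈ SP ∧ s + r ∉ SP} with hX1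
  have hX2 : {s : ℕ | s ∈ SQ ∧ ∀ u ∈ SQ, (u : ℤ) ≠ (s : ℤ) - (r : ℤ)}
      = insert 0 {s : ℕ | s ∈ SQ ∧ 0 < s ∧ (r ≤ s → s - r ∉ SQ)} := by
    ext s
    simp only [Set.mem_setOf_eq, Set.mem_insert_iff]
    constructor
    · rintro ⟨h, hu⟩
      rcases Nat.eq_zero_or_pos s with h0 | h0
      · exact Or.inl h0
      · exact Or.inr ⟨h, h0, fun hrs hm => hu _ hm (by omega)⟩
    · rintro (rfl | ⟨h, h0, hs⟩)
      · exact ⟨hQ0, fun u _ => by omega⟩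
      · refine ⟨h, fun u hu he => hs (by omega) ?_⟩
        rwa [show s - r = u by omega]
  rw [hX2]
  set X2 := {s : ℕ | s ∈ SQ ∧ 0 < s ∧ (r ≤ s → s - r ∉ SQ)} with hX2d
  have f1 : X1.Finite := by
    refine (Set.finite_Iic γ).subset fun s hs => ?_
    have := hγmax _ hs.2
    simp only [Set.mem_Iic]; omega
  have f2 : X2.Finite := by
    refine ((Set.finite_Iio r).union (hQfin.image (· + r))).subset fun s hs => ?_
    rcases lt_or_ge s r with h | h
    · exact Or.inl h
    · exact Or.inr ⟨s - r, hs.2.2 h, by simp only; omega⟩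
  have b1 : ∀ s ∈ X1, s + r ≤ γ := fun s hs => hγmax _ hs.2
  have b2 : ∀ s ∈ X2, r ≤ γ + s := fun s hs => by
    rcases lt_or_ge s r with h | h
    · have := hγmax _ (hcond s hs.1 hs.2.1 h)
      omega
    · omega
  rw [Set.ncard_insert_of_notMem (fun h => absurd h.2.1 (lt_irrefl 0)) f2, ← add_assoc]
  congr 1
  have i1 : Set.InjOn (fun s => γ - (s + r)) X1 := by
    intro a ha b hb h
    have := b1 a ha
    have := b1 b hb
    simp only at h; omega
  have i2 : Set.InjOn (fun s => γ + s - r) X2 := by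
    intro a ha b hb h
    have := b2 a ha
    have := b2 b hb
    simp only at h; omega
  rw [← i1.ncard_image, ← i2.ncard_image, ← Set.ncard_union_eq _ (f1.image _) (f2.image _)]
  · congr 1
    ext e
    simp only [Set.mem_union, Set.mem_image, Set.mem_setOf_eq]
    constructor
    · rintro (⟨s, hs, rfl⟩ | ⟨s, hs, rfl⟩)
      · have hb := b1 s hs
        have e1 : γ - (γ - (s + r)) = s + r := by omega
        have e2 : γ - (γ - (s + r) + r) = s := by omega
        refine ⟨Or.inl ⟨by omega, by rw [e1]; exact hs.2⟩, ?_⟩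
        rintro (⟨_, h⟩ | ⟨h1, h⟩)
        · rw [e2] at h; exact h hs.1
        · rw [show γ - (s + r) + r - γ = 0 by omega] at h; exact h hQ0
      · have hb := b2 s hs
        have h0 := hs.2.1
        constructor
        · rcases lt_or_ge s r with h | h
          · left
            refine ⟨by omega, ?_⟩
            rw [show γ - (γ + s - r) = r - s by omega]
            exact hcond s hs.1 h0 h
          · right
            refine ⟨by omega, ?_⟩
            rw [show γ + s - r - γ = s - r by omega]
            exact hs.2.2 h
        · rintro (⟨h1, _⟩ | ⟨_, h⟩)
          · omega
          · rw [show γ + s - r + r - γ = s by omega] at h; exact h hs.1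
    · rintro ⟨h, hn⟩
      push Not at hn
      obtain ⟨n1, n2⟩ := hn
      rcases le_or_gt (e + r) γ with hle | hgt
      · left
        refine ⟨γ - (e + r), ⟨n1 hle, ?_⟩, by omega⟩
        rw [show γ - (e + r) + r = γ - e by omega]
        rcases h with ⟨_, h⟩ | ⟨h1, _⟩
        · exact h
        · omega
      · right
        refine ⟨e + r - γ, ⟨n2 hgt.le, by omega, fun hrs => ?_⟩, by omega⟩
        rw [show e + r - γ - r = e - γ by omega]
        rcases h with ⟨h1, h⟩ | ⟨_, h⟩
        · rw [show γ - e = 0 by omega] at h; exact absurd hP0 h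
        · exact h
  · rw [Set.disjoint_left]
    rintro _ ⟨a, ha, rfl⟩ ⟨b, hb, h⟩
    have := b1 a ha
    have := b2 b hb
    have := hb.2.1
    simp only at h; omega
end

section
/- Let S_P ⊊ ℕ and S_Q ⊆ ℕ be numerical semigroups with gap sets G_P := ℕ ∖ S_P and G_Q := ℕ ∖ S_Q, and let γ := max G_P be the Frobenius number of S_P. Set A := {γ − g : g ∈ G_P} ∪ {γ + g : g ∈ G_Q} ⊆ ℕ. Let r be an integer and s ∈ S_Q with 0 < s < r and r − s ∈ S_P. Then every e ∈ A with e + (r − s) ∉ A also satisfies e + r ∉ A; that is, {e ∈ A : e + (r − s) ∉ A} ⊆ {e ∈ A : e + r ∉ A}. -/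
/-- In the proof of Theorem 4.3 of the paper: for `A = (γ − G_P) ∪ (γ + G_Q)` the
exponent set of the canonical model, if `s ∈ S_Q` with `0 < s < r` and `r − s ∈ S_P`,
then every ending element of `A` for the common difference `r − s` is also an ending
element for the common difference `r`. -/
theorem stmt_10 (SP SQ : Set ℕ)
    (hP0 : 0 ∈ SP) (hPadd : ∀ a ∈ SP, ∀ b ∈ SP, a + b ∈ SP) (hPfin : SPᶜ.Finite)
    (hPne : SP ≠ Set.univ)
    (hQ0 : 0 ∈ SQ) (hQadd : ∀ a ∈ SQ, ∀ b ∈ SQ, a + b ∈ SQ) (hQfin : SQᶜ.Finite)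
    (γ : ℕ) (hγ : γ ∉ SP) (hγmax : ∀ g : ℕ, g ∉ SP → g ≤ γ)
    (r s : ℕ) (hs : s ∈ SQ) (hs0 : 0 < s) (hsr : s < r) (hrs : r - s ∈ SP) :
    {e : ℕ | e ∈ ({n : ℕ | ∃ g : ℕ, g ∉ SP ∧ n = γ - g}
          ∪ {n : ℕ | ∃ g : ℕ, g ∉ SQ ∧ n = γ + g})
        ∧ e + (r - s) ∉ ({n : ℕ | ∃ g : ℕ, g ∉ SP ∧ n = γ - g}
          ∪ {n : ℕ | ∃ g : ℕ, g ∉ SQ ∧ n = γ + g})}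
      ⊆ {e : ℕ | e ∈ ({n : ℕ | ∃ g : ℕ, g ∉ SP ∧ n = γ - g}
          ∪ {n : ℕ | ∃ g : ℕ, g ∉ SQ ∧ n = γ + g})
        ∧ e + r ∉ ({n : ℕ | ∃ g : ℕ, g ∉ SP ∧ n = γ - g}
          ∪ {n : ℕ | ∃ g : ℕ, g ∉ SQ ∧ n = γ + g})} := by
  rintro e ⟨heA, hne⟩
  refine ⟨heA, ?_⟩
  -- the element `e + (r - s)` lies at or above `γ`
  have hge : γ ≤ e + (r - s) := by
    rcases heA with ⟨g, hg, rfl⟩ | ⟨g, hg, rfl⟩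
    · by_contra hlt
      have hgγ := hγmax g hg
      apply hne
      left
      refine ⟨g - (r - s), fun hmem => hg ?_, by omega⟩
      have h := hPadd _ hmem _ hrs
      rwa [show g - (r - s) + (r - s) = g by omega] at h
    · omega
  obtain ⟨m, hm⟩ := Nat.exists_eq_add_of_le hge
  have hmQ : m ∈ SQ := by
    by_contra hmQ
    exact hne (Or.inr ⟨m, hmQ, hm⟩)
  have hmsQ := hQadd m hmQ s hs
  rintro (⟨g, hg, h⟩ | ⟨g, hg, h⟩)
  · omega
  · apply hg
    rwa [show g = m + s by omega]
end

section
/- Let k be an algebraically closed field, let N ≥ 1, and let 0 = a_0 < a_1 < ⋯ < a_N be natural numbers. Fix d ≥ 1 and integers 0 ≤ m_1 ≤ ⋯ ≤ m_d with (m_1 + 1) + ⋯ + (m_d + 1) = N + 1. Then the following are equivalent: (i) there is a bijection σ from the set of pairs {(i,j) : 1 ≤ i ≤ d, 0 ≤ j ≤ m_i} to {0, 1, …, N} such that for every t ∈ k and for all pairs (i,j), (i′,j′) with 0 ≤ j ≤ m_i − 1 and 0 ≤ j′ ≤ m_{i′} − 1, one has t^{a_{σ(i,j)}} · t^{a_{σ(i′,j′+1)}}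 = t^{a_{σ(i,j+1)}} · t^{a_{σ(i′,j′)}} (i.e., after reordering the coordinates by σ, the point (t^{a_0} : ⋯ : t^{a_N}) annihilates all 2×2 minors of the matrix defining the scroll S_{m_1,…,m_d}); (ii) the set {a_0, a_1, …, a_N} can be partitioned into d subsets of cardinalities m_1 + 1, …, m_d + 1 such that each subset, listed in increasing order, is an arithmetic progression, and all these progressions have the same common difference. -/
theorem exp_eq_of_pow_eq {k : Type*} [Field k] [Infinite k] {p q : ℕ}
    (h : ∀ t : k, t ^ p = t ^ q) : p = q := by
  have h1 : (Polynomial.X ^ p : Polynomial k) = Polynomial.X ^ q :=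
    Polynomial.funext (fun t => by simpa using h t)
  simpa using congrArg Polynomial.natDegree h1

/-- A family of sequences with equal consecutive differences has a common difference. -/
theorem exists_common_diff {d : ℕ} (m : Fin d → ℕ) (b : Fin d → ℕ → ℕ)
    (h : ∀ i i' j j', j < m i → j' < m i' → b i j + b i' (j' + 1) = b i (j + 1) + b i' j') :
    ∃ δ : ℤ, ∀ i j, j ≤ m i → (b i j : ℤ) = b i 0 + j * δ := by
  by_cases hx : ∃ i, 0 < m i
  · obtain ⟨i₀, hi₀⟩ := hx
    refine ⟨(b i₀ 1 : ℤ) - b i₀ 0, fun i j => ?_⟩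
    induction j with
    | zero => intro _; simp
    | succ j ih =>
      intro hj
      have h1 := ih (by omega)
      have h2 := h i i₀ j 0 (by omega) hi₀
      simp only [zero_add] at h2
      push_cast
      rw [add_mul, ← add_assoc, ← h1]
      omega
  · push Not at hx
    refine ⟨0, fun i j hj => ?_⟩
    have := hx i
    obtain rfl : j = 0 := by omega
    simp

/-- Lemma 4.2 of the paper: a rational monomial curve `(1 : t^{a_1} : ⋯ : t^{a_N}) ⊆ ℙ^N`
lies on a `d`-fold scroll `S_{m_1,…,m_d}` (after reordering coordinates) if and only if
the exponent set `{a_0, a_1, …, a_N}` can be partitioned into `d` subsets of cardinalities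
`m_1 + 1, …, m_d + 1`, each an arithmetic progression, with a common difference shared by
all of them. -/
theorem stmt_13 (k : Type*) [Field k] [IsAlgClosed k]
    (N : ℕ) (hN : 1 ≤ N) (a : Fin (N + 1) → ℕ) (ha0 : a 0 = 0) (hmono : StrictMono a)
    (d : ℕ) (hd : 1 ≤ d) (m : Fin d → ℕ) (hm : Monotone m)
    (hsum : ∑ i, (m i + 1) = N + 1) :
    (∃ σ : (Σ i : Fin d, Fin (m i + 1)) ≃ Fin (N + 1),
        ∀ t : k, ∀ (i i' : Fin d) (j : Fin (m i + 1)) (j' : Fin (m i' + 1))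
          (hj : (j : ℕ) < m i) (hj' : (j' : ℕ) < m i'),
          t ^ a (σ ⟨i, j⟩) * t ^ a (σ ⟨i', ⟨(j' : ℕ) + 1, by omega⟩⟩)
            = t ^ a (σ ⟨i, ⟨(j : ℕ) + 1, by omega⟩⟩) * t ^ a (σ ⟨i', j'⟩))
    ↔ (∃ (B : Fin d → Finset ℕ) (r : ℕ),
        (∀ i i' : Fin d, i ≠ i' → Disjoint (B i) (B i'))
        ∧ Finset.univ.biUnion B = Finset.image a Finset.univ
        ∧ (∀ i, (B i).card = m i + 1)
        ∧ (∀ i, ∃ c : ℕ, B i = Finset.image (fun j => c + j * r) (Finset.range (m i + 1)))) := by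
  classical
  constructor
  · rintro ⟨σ, hσ⟩
    let b : Fin d → ℕ → ℕ := fun i j => if h : j < m i + 1 then a (σ ⟨i, ⟨j, h⟩⟩) else 0
    have hb : ∀ i j (h : j < m i + 1), b i j = a (σ ⟨i, ⟨j, h⟩⟩) := fun i j h => by
      simp only [b, dif_pos h]
    have hinj : ∀ i i' j j', j < m i + 1 → j' < m i' + 1 → b i j = b i' j' → i = i' ∧ j = j' := by
      intro i i' j j' h h' he
      rw [hb i j h, hb i' j' h'] at he
      have := σ.injective (hmono.injective he)
      obtain ⟨rfl, h2⟩ := Sigma.mk.inj_iff.1 this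
      have h3 := eq_of_heq h2
      exact ⟨rfl, by simpa using h3⟩
    obtain ⟨δ, hδ⟩ := exists_common_diff m b (by
      intro i i' j j' hj hj'
      rw [hb i j (by omega), hb i' j' (by omega), hb i (j+1) (by omega), hb i' (j'+1) (by omega)]
      apply exp_eq_of_pow_eq (k := k)
      intro t
      rw [pow_add, pow_add]
      exact hσ t i i' ⟨j, by omega⟩ ⟨j', by omega⟩ hj hj')
    refine ⟨fun i => Finset.image (b i) (Finset.range (m i + 1)), δ.natAbs, ?_, ?_, ?_, ?_⟩
    · intro i i' hne
      rw [Finset.disjoint_left]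
      intro x hx hx'
      simp only [Finset.mem_image, Finset.mem_range] at hx hx'
      obtain ⟨j, hj, rfl⟩ := hx
      obtain ⟨j', hj', he⟩ := hx'
      exact hne (hinj _ _ _ _ hj hj' he.symm).1
    · ext x
      simp only [Finset.mem_biUnion, Finset.mem_univ, true_and, Finset.mem_image, Finset.mem_range]
      constructor
      · rintro ⟨i, j, hj, rfl⟩
        exact ⟨_, (hb i j hj).symm⟩
      · rintro ⟨n, rfl⟩
        refine ⟨(σ.symm n).1, (σ.symm n).2, (σ.symm n).2.2, ?_⟩
        rw [hb _ _ (σ.symm n).2.2]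
        simp
    · intro i
      rw [Finset.card_image_of_injOn, Finset.card_range]
      intro j hj j' hj' he
      exact (hinj i i j j' (by simpa using hj) (by simpa using hj') he).2
    · intro i
      rcases le_total 0 δ with h0 | h0
      · refine ⟨b i 0, Finset.image_congr ?_⟩
        intro j hj
        have hj : j < m i + 1 := by simpa using hj
        have := hδ i j (by omega)
        zify
        rw [abs_of_nonneg h0]
        exact this
      · refine ⟨b i (m i), ?_⟩
        have key : ∀ j j', j + j' = m i → b i j = b i (m i) + j' * δ.natAbs := by
          intro j j' hjj
          have h1 := hδ i j (by omega)
          have h2 := hδ i (m i) le_rfl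
          zify
          rw [abs_of_nonpos h0, h1, h2, ← hjj]
          push_cast
          ring
        ext x
        simp only [Finset.mem_image, Finset.mem_range]
        constructor
        · rintro ⟨j, hj, rfl⟩
          exact ⟨m i - j, by omega, (key _ _ (by omega)).symm⟩
        · rintro ⟨j, hj, rfl⟩
          exact ⟨m i - j, by omega, key _ _ (by omega)⟩
  · rintro ⟨B, r, hdisj, hun, hcard, hB⟩
    choose c hc using hB
    have hmem : ∀ i j, j < m i + 1 → c i + j * r ∈ B i := by
      intro i j hj
      rw [hc i]
      exact Finset.mem_image_of_mem _ (Finset.mem_range.2 hj)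
    have hex : ∀ p : (Σ i : Fin d, Fin (m i + 1)), ∃ n, a n = c p.1 + (p.2 : ℕ) * r := by
      rintro ⟨i, j⟩
      have h1 : c i + (j : ℕ) * r ∈ Finset.univ.biUnion B :=
        Finset.mem_biUnion.2 ⟨i, Finset.mem_univ _, hmem i j j.2⟩
      rw [hun] at h1
      simpa using h1
    choose f hf using hex
    have hfi : Function.Injective f := by
      rintro ⟨i, j⟩ ⟨i', j'⟩ he
      have h1 : c i + (j : ℕ) * r = c i' + (j' : ℕ) * r := by
        rw [← hf ⟨i, j⟩, ← hf ⟨i', j'⟩, he]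
      have hi : i = i' := by
        by_contra hne
        refine Finset.disjoint_left.1 (hdisj i i' hne) (hmem i j j.2) ?_
        rw [h1]
        exact hmem i' j' j'.2
      subst hi
      have h2 : Set.InjOn (fun j => c i + j * r) (Finset.range (m i + 1) : Set ℕ) := by
        apply Finset.card_image_iff.1
        rw [← hc i, hcard i, Finset.card_range]
      have h3 : (j : ℕ) = j' := h2 (by simp; omega) (by simp; omega) h1
      rw [Fin.ext h3]
    have hbij : Function.Bijective f :=
      (Fintype.bijective_iff_injective_and_card f).2 ⟨hfi, by simp [hsum]⟩
    refine ⟨Equiv.ofBijective f hbij, ?_⟩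
    intro t i i' j j' hj hj'
    simp only [Equiv.ofBijective_apply, hf, ← pow_add]
    congr 1
    ring
end
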